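/- arXiv:1307.2463 — 2 statements merged into one kernel-verified Lean document; each statement's English description precedes it below -/
import Mathlib

section
/- For g = 2, the five Heisenberg-invariant quartics P₀ = ∑_σ x_σ⁴, P₁ = 2(x₀₀²x₀₁² + x₁₀²x₁₁²), P₂ = 2(x₀₀²x₁₀² + x₀₁²x₁₁²), P₃ = 2(x₀₀²x₁₁² + x₀₁²x₁₀²), P₁₂ = 4x₀₀x₀₁x₁₀x₁₁ are linearly independent over ℂ, and every quartic polynomial in ℂ[x₀₀, x₀₁, x₁₀, x₁₁] invariant under all sign changes x_σ ↦ (−1)^{σ·a} x_σ and all translations x_σ ↦ x_{σ+b} (a, b ∈ (ℤ/2ℤ)²) is a linear combination of P₀, P₁, P₂, P₃, P₁₂. -/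
open MvPolynomial

/-- `(ℤ/2ℤ)²`. -/
abbrev V2 : Type := ZMod 2 × ZMod 2

/-- The five Heisenberg-invariant quartics `P₀, P₁, P₂, P₃, P₁₂` for `g = 2`. -/
noncomputable def hq : Fin 5 → MvPolynomial V2 ℂ :=
  ![X (0, 0) ^ 4 + X (0, 1) ^ 4 + X (1, 0) ^ 4 + X (1, 1) ^ 4,
    2 * (X (0, 0) ^ 2 * X (0, 1) ^ 2 + X (1, 0) ^ 2 * X (1, 1) ^ 2),
    2 * (X (0, 0) ^ 2 * X (1, 0) ^ 2 + X (0, 1) ^ 2 * X (1, 1) ^ 2),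
    2 * (X (0, 0) ^ 2 * X (1, 1) ^ 2 + X (0, 1) ^ 2 * X (1, 0) ^ 2),
    4 * (X (0, 0) * X (0, 1) * X (1, 0) * X (1, 1))]

/-- The sign change `x_σ ↦ (−1)^{σ·a} x_σ`, as an algebra endomorphism of `ℂ[x]`. -/
noncomputable def signChange (a : V2) : MvPolynomial V2 ℂ →ₐ[ℂ] MvPolynomial V2 ℂ :=
  aeval fun σ : V2 =>
    ((-1 : ℂ) ^ (σ.1 * a.1 + σ.2 * a.2 : ZMod 2).val) • (X σ : MvPolynomial V2 ℂ)

/-- Rescaling the variables by `c` multiplies the coefficient of `x^m` by `c^m`. -/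
theorem coeff_aeval_smul_X {ι R : Type*} [CommSemiring R] (c : ι → R) (F : MvPolynomial ι R)
    (m : ι →₀ ℕ) :
    coeff m (aeval (fun i => c i • (X i : MvPolynomial ι R)) F) =
      (m.prod fun i k => c i ^ k) * coeff m F := by
  classical
  induction F using MvPolynomial.induction_on' with
  | monomial s a =>
    have h : aeval (fun i => c i • (X i : MvPolynomial ι R)) (monomial s a) =
        monomial s ((s.prod fun i k => c i ^ k) * a) := by
      rw [aeval_monomial, monomial_eq, algebraMap_eq, C_mul]
      simp only [smul_eq_C_mul, Finsupp.prod, mul_pow, Finset.prod_mul_distrib, map_prod, C_pow]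
      ring
    rw [h, coeff_monomial, coeff_monomial]
    split_ifs with hs
    · rw [hs]
    · simp
  | add p q hp hq => rw [map_add, coeff_add, coeff_add, hp, hq, mul_add]

theorem V2.sum_univ {M : Type*} [AddCommMonoid M] (f : V2 → M) :
    ∑ σ, f σ = f (0, 0) + f (0, 1) + f (1, 0) + f (1, 1) := by
  rw [Fintype.sum_prod_type]
  change ∑ i : Fin 2, ∑ j : Fin 2, f (i, j) = _
  simp only [Fin.sum_univ_two, ← add_assoc]
  rfl

theorem V2.prod_univ {M : Type*} [CommMonoid M] (f : V2 → M) :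
    ∏ σ, f σ = f (0, 0) * f (0, 1) * f (1, 0) * f (1, 1) :=
  V2.sum_univ (M := Additive M) f

/-- A sign-invariant polynomial only contains monomials of trivial character. -/
theorem even_of_signChange_eq {F : MvPolynomial V2 ℂ} (hF : ∀ a, signChange a F = F)
    {m : V2 →₀ ℕ} (hm : m ∈ F.support) :
    Even (m (0, 1) + m (1, 1)) ∧ Even (m (1, 0) + m (1, 1)) := by
  have key (a : V2) : (m.prod fun σ k =>
      ((-1 : ℂ) ^ (σ.1 * a.1 + σ.2 * a.2 : ZMod 2).val) ^ k) = 1 := by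
    have h := coeff_aeval_smul_X
      (fun σ : V2 => (-1 : ℂ) ^ (σ.1 * a.1 + σ.2 * a.2 : ZMod 2).val) F m
    have h' := congrArg (coeff m) (hF a)
    rw [signChange, h] at h'
    exact (mul_eq_right₀ (mem_support_iff.mp hm)).mp h'
  have one_val : (1 : ZMod 2).val = 1 := rfl
  have h₁ := key (0, 1)
  have h₂ := key (1, 0)
  rw [Finsupp.prod_fintype _ _ (by simp), V2.prod_univ] at h₁ h₂
  simp [one_val, ← pow_add] at h₁ h₂
  exact ⟨(neg_one_pow_eq_one_iff_even (by norm_num)).mp h₁,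
    (neg_one_pow_eq_one_iff_even (by norm_num)).mp h₂⟩

/-- The orbit sum of a quartic monomial of trivial character. -/
theorem sum_rename_monomial_mem {m : V2 →₀ ℕ} (hdeg : m.degree = 4)
    (h₁ : Even (m (0, 1) + m (1, 1))) (h₂ : Even (m (1, 0) + m (1, 1))) :
    ∑ b : V2, rename (fun σ : V2 => σ + b) (monomial m (1 : ℂ)) ∈
      Submodule.span ℂ (Set.range hq) := by
  have mem (i : Fin 5) {P : MvPolynomial V2 ℂ} (hP : P = hq i) :
      P ∈ Submodule.span ℂ (Set.range hq) :=
    Submodule.subset_span ⟨i, hP.symm⟩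
  rw [Finsupp.degree_eq_sum, V2.sum_univ] at hdeg
  simp only [monomial_eq, Finsupp.prod_fintype, pow_zero, implies_true, V2.prod_univ,
    V2.sum_univ, map_one, one_mul, map_mul, map_pow, rename_X]
  have one_add_one : (1 + 1 : ZMod 2) = 0 := rfl
  simp only [Prod.mk_add_mk, add_zero, zero_add, one_add_one]
  generalize m (0, 0) = p, m (0, 1) = q, m (1, 0) = r, m (1, 1) = s at *
  have hm : p = 4 ∧ q = 0 ∧ r = 0 ∧ s = 0 ∨ p = 0 ∧ q = 4 ∧ r = 0 ∧ s = 0 ∨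
      p = 0 ∧ q = 0 ∧ r = 4 ∧ s = 0 ∨ p = 0 ∧ q = 0 ∧ r = 0 ∧ s = 4 ∨
      p = 2 ∧ q = 2 ∧ r = 0 ∧ s = 0 ∨ p = 0 ∧ q = 0 ∧ r = 2 ∧ s = 2 ∨
      p = 2 ∧ q = 0 ∧ r = 2 ∧ s = 0 ∨ p = 0 ∧ q = 2 ∧ r = 0 ∧ s = 2 ∨
      p = 2 ∧ q = 0 ∧ r = 0 ∧ s = 2 ∨ p = 0 ∧ q = 2 ∧ r = 2 ∧ s = 0 ∨
      p = 1 ∧ q = 1 ∧ r = 1 ∧ s = 1 := by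
    rw [Nat.even_iff] at h₁ h₂
    have hq : q ≤ 4 := by omega
    have hr : r ≤ 4 := by omega
    have hs : s ≤ 4 := by omega
    clear mem one_add_one
    interval_cases q <;> interval_cases r <;> interval_cases s <;>
      first
      | (exfalso; omega)
      | (simp; omega)
  rcases hm with h | h | h | h | h | h | h | h | h | h | h <;>
    obtain ⟨rfl, rfl, rfl, rfl⟩ := h
  iterate 4
    · refine mem 0 ?_
      simp only [hq, Matrix.cons_val]
      ring
  iterate 2
    · refine mem 1 ?_
      simp only [hq, Matrix.cons_val]
      ring
  iterate 2
    · refine mem 2 ?_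
      simp only [hq, Matrix.cons_val]
      ring
  iterate 2
    · refine mem 3 ?_
      simp only [hq, Matrix.cons_val]
      ring
  · refine mem 4 ?_
    simp only [hq, Matrix.cons_val]
    ring

/-- For `g = 2`: `P₀, P₁, P₂, P₃, P₁₂` are linearly independent, and every
Heisenberg-invariant quartic (invariant under all sign changes and translations)
is a linear combination of them. -/
theorem heisenberg_invariant_quartics_g2 :
    LinearIndependent ℂ hq ∧
    ∀ F : MvPolynomial V2 ℂ, F.IsHomogeneous 4 →
      (∀ a : V2, signChange a F = F) →
      (∀ b : V2, rename (fun σ : V2 => σ + b) F = F) →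
      F ∈ Submodule.span ℂ (Set.range hq) := by
  refine ⟨?_, fun F hF hsign htrans => ?_⟩
  · rw [Fintype.linearIndependent_iff]
    intro g hg
    have ev (x : V2 → ℂ) := congrArg (eval x) hg
    simp only [Fin.sum_univ_five, hq, smul_eq_C_mul] at ev
    have e₀ := ev fun σ => if σ = (0, 0) then 1 else 0
    have e₁ := ev fun σ => if σ.1 = 0 then 1 else 0
    have e₂ := ev fun σ => if σ.2 = 0 then 1 else 0
    have e₃ := ev fun σ => if σ.1 = σ.2 then 1 else 0
    have e₄ := ev fun _ => 1
    simp at e₀ e₁ e₂ e₃ e₄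
    intro i
    fin_cases i <;> grind
  · have hsum : ∑ b : V2, rename (fun σ : V2 => σ + b) F = (4 : ℂ) • F := by
      simp only [htrans, V2.sum_univ]
      module
    have hF4 : (4 : ℂ) • F ∈ Submodule.span ℂ (Set.range hq) := by
      rw [← hsum]
      have expand (b : V2) : rename (fun σ : V2 => σ + b) F =
          ∑ m ∈ F.support, rename (fun σ : V2 => σ + b) (monomial m (coeff m F)) := by
        conv_lhs => rw [F.as_sum, map_sum]
      simp only [expand]
      rw [Finset.sum_comm]
      refine Submodule.sum_mem _ fun m hm => ?_
      obtain ⟨h₁, h₂⟩ := even_of_signChange_eq hsign hm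
      have hdeg : m.degree = 4 := by
        rw [Finsupp.degree_eq_weight_one]
        exact hF (mem_support_iff.mp hm)
      have hmon : monomial m (coeff m F) = coeff m F • monomial m (1 : ℂ) := by
        rw [smul_monomial, smul_eq_mul, mul_one]
      simp only [hmon, map_smul, ← Finset.smul_sum]
      exact Submodule.smul_mem _ _ (sum_rename_monomial_mem hdeg h₁ h₂)
    exact (Submodule.smul_mem_iff _ (by norm_num)).mp hF4
end

section
/- The dimension of the space of quartic polynomials in 2^g variables invariant under all sign changes x_σ ↦ (−1)^{σ·a} x_σ (a ∈ (ℤ/2ℤ)^g) and spanned, for each subgroup T = {0,α,β,α+β} of order ≤ 4 of (ℤ/2ℤ)^g, by the polynomials P_T, equals (2^g + 1)(2^{g−1} + 1)/3; i.e., the P_T indexed by distinct subgroups T of order at most 4 are linearly independent in ℂ[x]₄. -/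
open MvPolynomial

/-- The group `(ℤ/2ℤ)^g`. -/
abbrev Vg (g : ℕ) : Type := Fin g → ZMod 2

instance (g : ℕ) : Finite (AddSubgroup (Vg g)) :=
  Finite.of_injective (fun T => (T : Set (Vg g))) SetLike.coe_injective

/-- The subgroups of `(ℤ/2ℤ)^g` of order at most four; these index the variables `p_T`. -/
abbrev SmallSubgroup (g : ℕ) : Type := {T : AddSubgroup (Vg g) // Nat.card T ≤ 4}

noncomputable instance (g : ℕ) : Fintype (SmallSubgroup g) := Fintype.ofFinite _

/-- For a subgroup `T = {0, α, β, α+β}` of order at most `4`, the Heisenberg-invariant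
quartic `P_T := ∑_ρ x_ρ x_{ρ+α} x_{ρ+β} x_{ρ+α+β}`, written intrinsically as
`∑_ρ (∏_{t ∈ T} x_{ρ+t})^{4/|T|}`. -/
noncomputable def PT {g : ℕ} (T : AddSubgroup (Vg g)) : MvPolynomial (Vg g) ℂ :=
  letI := Classical.decPred (fun t : Vg g => t ∈ T)
  ∑ ρ : Vg g,
    (∏ t ∈ Finset.univ.filter (fun t : Vg g => t ∈ T), X (ρ + t)) ^ (4 / Nat.card T)

/-- The exponent vector of the summand of `PT T` with index `ρ`. -/
noncomputable def cosetExponent {g : ℕ} (T : AddSubgroup (Vg g)) (ρ : Vg g) : Vg g →₀ ℕ :=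
  letI := Classical.decPred (fun t : Vg g => t ∈ T)
  (4 / Nat.card T) •
    (∑ t ∈ Finset.univ.filter (fun t : Vg g => t ∈ T), Finsupp.single (ρ + t) 1)

open scoped Classical in
theorem coeff_PT {g : ℕ} (T : AddSubgroup (Vg g)) (m : Vg g →₀ ℕ) :
    (PT T).coeff m = ∑ ρ : Vg g, if cosetExponent T ρ = m then (1 : ℂ) else 0 := by
  simp only [PT, coeff_sum]
  refine Finset.sum_congr rfl fun ρ _ => ?_
  rw [← coeff_monomial, cosetExponent, ← one_pow (M := ℂ) (4 / Nat.card T), ← monomial_pow,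
    monomial_sum_one]
  rfl

theorem cosetExponent_apply_ne_zero {g : ℕ} {T : AddSubgroup (Vg g)} (hT : Nat.card T ≤ 4)
    (ρ v : Vg g) : cosetExponent T ρ v ≠ 0 ↔ v - ρ ∈ T := by
  classical
  have h4 : 4 / Nat.card T ≠ 0 := (Nat.div_pos hT Nat.card_pos).ne'
  have h (t : Vg g) : ρ + t = v ↔ t = v - ρ := by
    rw [eq_sub_iff_add_eq, add_comm]
  rw [cosetExponent, Finsupp.smul_apply, smul_eq_mul, mul_ne_zero_iff_left h4]
  simp [Finsupp.single_apply, h]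

theorem eq_of_cosetExponent_eq {g : ℕ} {S T : AddSubgroup (Vg g)} (hS : Nat.card S ≤ 4)
    (hT : Nat.card T ≤ 4) {ρ : Vg g} (h : cosetExponent S ρ = cosetExponent T 0) : S = T := by
  have key (v : Vg g) : v - ρ ∈ S ↔ v ∈ T := by
    rw [← cosetExponent_apply_ne_zero hS, h, cosetExponent_apply_ne_zero hT, sub_zero]
  have hρ : ρ ∈ S := by simpa using (key 0).2 T.zero_mem
  ext v
  rw [← key]
  exact ⟨fun hv => S.sub_mem hv hρ, fun hv => by simpa using S.add_mem hv hρ⟩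

theorem PT_linearIndependent (g : ℕ) :
    LinearIndependent ℂ (fun T : SmallSubgroup g => PT T.1) := by
  classical
  rw [Fintype.linearIndependent_iff]
  intro c hc T
  have h := congrArg (coeff (cosetExponent T.1 0)) hc
  rw [coeff_sum, Finset.sum_eq_single T] at h
  · rw [coeff_smul, smul_eq_mul, coeff_zero, mul_eq_zero] at h
    refine h.resolve_right ?_
    rw [coeff_PT, Finset.sum_boole]
    refine Nat.cast_ne_zero.2 ?_
    exact Finset.card_ne_zero_of_mem (Finset.mem_filter.2 ⟨Finset.mem_univ 0, rfl⟩)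
  · intro S _ hST
    rw [coeff_smul, coeff_PT, Finset.sum_eq_zero, smul_zero]
    intro ρ _
    exact if_neg fun hρ => hST (Subtype.ext (eq_of_cosetExponent_eq S.2 T.2 hρ))
  · simp

theorem Vg.add_self {g : ℕ} (x : Vg g) : x + x = 0 :=
  funext fun i => CharTwo.add_self_eq_zero (x i)

/-- The subgroup `{0, x, y, x + y}` generated by `x` and `y`. -/
def pairSubgroup {g : ℕ} (x y : Vg g) : AddSubgroup (Vg g) where
  carrier := ↑({0, x, y, x + y} : Finset (Vg g))
  zero_mem' := by simp
  add_mem' := by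
    have hx := Vg.add_self x
    have hy := Vg.add_self y
    intro a b ha hb
    simp only [Finset.coe_insert, Finset.coe_singleton, Set.mem_insert_iff,
      Set.mem_singleton_iff] at ha hb ⊢
    grind
  neg_mem' := by
    intro a ha
    rwa [neg_eq_of_add_eq_zero_left (Vg.add_self a)]

theorem card_pairSubgroup_le {g : ℕ} (x y : Vg g) : Nat.card (pairSubgroup x y) ≤ 4 := by
  change Nat.card (({0, x, y, x + y} : Finset (Vg g)) : Set (Vg g)) ≤ 4
  rw [Nat.card_coe_set_eq, Set.ncard_coe_finset]
  exact Finset.card_le_four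

open Finset in
theorem pairSubgroup_eq_iff {g : ℕ} {T : AddSubgroup (Vg g)} [DecidablePred (· ∈ T)]
    (x y : Vg g) : pairSubgroup x y = T ↔ x ∈ T ∧ y ∈ T ∧
      Nat.card T ≤ #({0, x, y, x + y} : Finset (Vg g)) := by
  have hc : Nat.card T = #(univ.filter (· ∈ T)) := by
    rw [Nat.card_eq_fintype_card, Fintype.card_subtype]
  have h : pairSubgroup x y = T ↔ {0, x, y, x + y} = univ.filter (· ∈ T) := by
    rw [← SetLike.coe_set_eq, ← coe_inj]
    simp [pairSubgroup]
  rw [h, hc]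
  constructor
  · intro h
    have hmem (z : Vg g) (hz : z ∈ ({0, x, y, x + y} : Finset (Vg g))) : z ∈ T := by
      rw [h] at hz
      simpa using hz
    exact ⟨hmem x (by simp), hmem y (by simp), h ▸ le_rfl⟩
  · rintro ⟨hx, hy, hle⟩
    refine eq_of_subset_of_card_le ?_ hle
    intro z hz
    simp only [mem_insert, mem_singleton] at hz
    rw [mem_filter]
    refine ⟨mem_univ _, ?_⟩
    rcases hz with rfl | rfl | rfl | rfl
    exacts [T.zero_mem, hx, hy, T.add_mem hx hy]

theorem card_smallSubgroup_eq {g : ℕ} (T : SmallSubgroup g) :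
    Nat.card T.1 = 1 ∨ Nat.card T.1 = 2 ∨ Nat.card T.1 = 4 := by
  have hd : Nat.card T.1 ∣ 2 ^ g := by
    simpa using T.1.card_addSubgroup_dvd_card
  obtain ⟨k, -, hk⟩ := (Nat.dvd_prime_pow Nat.prime_two).1 hd
  have h4 := T.2
  have : k ≤ 2 := by
    rw [hk] at h4
    exact (Nat.pow_le_pow_iff_right (by norm_num)).1 (h4.trans_eq (by norm_num : 4 = 2 ^ 2))
  rw [hk]
  interval_cases k <;> simp

open Finset in
theorem card_zero_pair_add_iff {g : ℕ} (x y : Vg g) :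
    (2 ≤ #({0, x, y, x + y} : Finset (Vg g)) ↔ (x, y) ≠ (0, 0)) ∧
    (4 ≤ #({0, x, y, x + y} : Finset (Vg g)) ↔ x ≠ 0 ∧ y ≠ 0 ∧ x ≠ y) := by
  have hx := Vg.add_self x
  by_cases h0 : x = 0
  · subst h0
    by_cases hy : y = 0
    · simp [hy]
    · simp [hy, card_pair (Ne.symm hy)]
  by_cases h1 : y = 0
  · subst h1
    simp [h0, card_pair (Ne.symm h0)]
  by_cases h2 : x = y
  · subst h2
    simp [h0, hx, card_insert_of_notMem, Ne.symm h0]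
  · have h3 : x + y ≠ 0 := fun h => h2 (add_left_cancel (hx.trans h.symm))
    have : #({0, x, y, x + y} : Finset (Vg g)) = 4 := by
      rw [card_insert_of_notMem, card_insert_of_notMem, card_insert_of_notMem, card_singleton]
      all_goals simp [h0, h1, h2, Ne.symm h0, Ne.symm h1, Ne.symm h3]
    simp [this, h0, h1, h2]

open Finset in
open scoped Classical in
/-- Every small subgroup is hit six times by the ordered pairs of generators, the single
generators counted three times, and the trivial subgroup counted twice. -/
theorem card_generators_eq_six {g : ℕ} (T : SmallSubgroup g) :
    #{p : Vg g × Vg g | pairSubgroup p.1 p.2 = T.1} + 3 * #{x : Vg g | pairSubgroup x x = T.1}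
      + 2 * (if T.1 = ⊥ then 1 else 0) = 6 := by
  have hc : Nat.card T.1 = #(univ.filter (· ∈ T.1)) := by
    rw [Nat.card_eq_fintype_card, Fintype.card_subtype]
  have h0 : (0 : Vg g) ∈ univ.filter (· ∈ T.1) := by simp
  have hbot := AddSubgroup.card_eq_one (H := T.1)
  rcases card_smallSubgroup_eq T with h | h | h
  · have hT : T.1 = ⊥ := hbot.1 h
    have h1 : ({p : Vg g × Vg g | pairSubgroup p.1 p.2 = T.1} : Finset _) = {(0, 0)} := by
      ext ⟨x, y⟩
      simp +contextual [pairSubgroup_eq_iff, hT, Prod.ext_iff]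
    have h2 : ({x : Vg g | pairSubgroup x x = T.1} : Finset _) = {0} := by
      ext x
      simp +contextual [pairSubgroup_eq_iff, hT]
    rw [h1, h2, if_pos hT]
    simp
  · have hT : T.1 ≠ ⊥ := fun hT => absurd ((hbot.2 hT).symm.trans h) (by norm_num)
    have h1 : ({p : Vg g × Vg g | pairSubgroup p.1 p.2 = T.1} : Finset _)
        = (univ.filter (· ∈ T.1) ×ˢ univ.filter (· ∈ T.1)).erase (0, 0) := by
      ext ⟨x, y⟩
      rw [mem_filter, pairSubgroup_eq_iff, h, (card_zero_pair_add_iff x y).1]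
      simp only [mem_erase, mem_product, mem_filter, mem_univ, true_and]
      tauto
    have h2 : ({x : Vg g | pairSubgroup x x = T.1} : Finset _)
        = (univ.filter (· ∈ T.1)).erase 0 := by
      ext x
      rw [mem_filter, pairSubgroup_eq_iff, h, (card_zero_pair_add_iff x x).1]
      simp only [mem_erase, mem_filter, mem_univ, true_and, ne_eq, Prod.mk.injEq]
      tauto
    rw [h1, h2, if_neg hT, card_erase_of_mem (mk_mem_product h0 h0), card_erase_of_mem h0,
      card_product, ← hc, h]
  · have hT : T.1 ≠ ⊥ := fun hT => absurd ((hbot.2 hT).symm.trans h) (by norm_num)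
    have h1 : ({p : Vg g × Vg g | pairSubgroup p.1 p.2 = T.1} : Finset _)
        = ((univ.filter (· ∈ T.1)).erase 0).offDiag := by
      ext ⟨x, y⟩
      rw [mem_filter, pairSubgroup_eq_iff, h, (card_zero_pair_add_iff x y).2]
      simp only [mem_erase, mem_offDiag, mem_filter, mem_univ, true_and]
      tauto
    have h2 : ({x : Vg g | pairSubgroup x x = T.1} : Finset _) = ∅ := by
      ext x
      rw [mem_filter, pairSubgroup_eq_iff, h, (card_zero_pair_add_iff x x).2]
      simp
    rw [h1, h2, if_neg hT, offDiag_card, card_erase_of_mem h0, ← hc, h]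
    simp

open Finset in
theorem six_mul_card_smallSubgroup (g : ℕ) :
    6 * Fintype.card (SmallSubgroup g) = (2 ^ g + 1) * (2 ^ g + 2) := by
  classical
  have hV : Fintype.card (Vg g) = 2 ^ g := by simp
  let f (p : Vg g × Vg g) : SmallSubgroup g := ⟨pairSubgroup p.1 p.2, card_pairSubgroup_le _ _⟩
  have h1 : ∑ T : SmallSubgroup g, #{p : Vg g × Vg g | pairSubgroup p.1 p.2 = T.1}
      = 2 ^ g * 2 ^ g := by
    rw [← hV, ← Fintype.card_prod, ← card_univ,
      card_eq_sum_card_fiberwise (f := f) (t := univ) (by simp)]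
    simp [f, Subtype.ext_iff]
  have h2 : ∑ T : SmallSubgroup g, #{x : Vg g | pairSubgroup x x = T.1} = 2 ^ g := by
    rw [← hV, ← card_univ,
      card_eq_sum_card_fiberwise (f := fun x => f (x, x)) (t := univ) (by simp)]
    simp [f, Subtype.ext_iff]
  have h3 : ∑ T : SmallSubgroup g, (if T.1 = ⊥ then 1 else 0) = 1 := by
    rw [sum_eq_single (⟨⊥, by simp⟩ : SmallSubgroup g)]
    · simp
    · intro T _ hT
      exact if_neg fun h => hT (Subtype.ext h)
    · simp
  have h := sum_congr (rfl : (univ : Finset (SmallSubgroup g)) = univ)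
    fun T _ => card_generators_eq_six T
  rw [sum_add_distrib, sum_add_distrib, ← mul_sum, ← mul_sum, h1, h2, h3, sum_const, card_univ,
    smul_eq_mul] at h
  linarith

/-- The quartics `P_T`, indexed by the distinct subgroups `T` of order at most 4, are
linearly independent, and they span a space of dimension `(2^g + 1)(2^{g−1} + 1)/3`. -/
theorem PT_linearIndependent_and_dim (g : ℕ) (hg : 1 ≤ g) :
    LinearIndependent ℂ (fun T : SmallSubgroup g => PT T.1) ∧
    Module.finrank ℂ
        (Submodule.span ℂ (Set.range fun T : SmallSubgroup g => PT T.1))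
      = (2 ^ g + 1) * (2 ^ (g - 1) + 1) / 3 := by
  refine ⟨PT_linearIndependent g, ?_⟩
  rw [finrank_span_eq_card (PT_linearIndependent g)]
  obtain ⟨n, rfl⟩ := Nat.exists_eq_add_of_le' hg
  have h := six_mul_card_smallSubgroup (n + 1)
  rw [Nat.add_sub_cancel]
  have h' : (2 ^ (n + 1) + 1) * (2 ^ n + 1) = 3 * Fintype.card (SmallSubgroup (n + 1)) := by
    have : 2 ^ (n + 1) + 2 = 2 * (2 ^ n + 1) := by ring
    rw [this] at h
    linarith
  rw [h', Nat.mul_div_cancel_left _ (by norm_num)]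
end
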